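/- If n is divisible by 3, then for tilings of ℤ/nℤ by translates of the bar {0,1,2}, (1/n)·D*Δ⁻¹D equals the orthogonal projection onto the span of the subspaces U_z with z²+z+1 ≠ 0, and the complementary projection I − P₃ (onto U_ω ⊕ U_{ω²}, ω = e^{2πi/3}) has matrix entries (I−P₃)_{s,t} = (2/n)cos(2π(s−t)/3); in particular tile counts at distance a multiple of 3 are perfectly correlated. -/

import Mathlib

open Matrix

theorem Real.cos_two_pi_mul_natCast_div_three (k : ℕ) :
    Real.cos (2 * Real.pi * (k : ℝ) / 3) = if 3 ∣ k then 1 else -1 / 2 := by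
  have hk : (k : ℝ) = 3 * ((k / 3 : ℕ) : ℝ) + ((k % 3 : ℕ) : ℝ) := by
    exact_mod_cast (Nat.div_add_mod k 3).symm
  have hcos : Real.cos (2 * Real.pi * (k : ℝ) / 3)
      = Real.cos (2 * Real.pi * ((k % 3 : ℕ) : ℝ) / 3) := by
    rw [← Real.cos_add_nat_mul_two_pi (2 * Real.pi * ((k % 3 : ℕ) : ℝ) / 3) (k / 3)]
    congr 1
    conv_lhs => rw [hk]
    ring
  rw [hcos]
  have hr : k % 3 = 0 ∨ k % 3 = 1 ∨ k % 3 = 2 := by omega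
  rcases hr with h | h | h
  · rw [h, if_pos (by omega)]
    simp
  · rw [h, if_neg (by omega), show 2 * Real.pi * ((1 : ℕ) : ℝ) / 3 = Real.pi - Real.pi / 3 by
      push_cast; ring, Real.cos_pi_sub, Real.cos_pi_div_three]
    norm_num
  · rw [h, if_neg (by omega), show 2 * Real.pi * ((2 : ℕ) : ℝ) / 3 = Real.pi / 3 + Real.pi by
      push_cast; ring, Real.cos_add_pi, Real.cos_pi_div_three]
    norm_num

theorem ZMod.three_dvd_val_iff {n : ℕ} [NeZero n] (hdvd : 3 ∣ n) (u : ZMod n) :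
    3 ∣ u.val ↔ ZMod.castHom hdvd (ZMod 3) u = 0 := by
  rw [← ZMod.natCast_eq_zero_iff]
  conv_rhs => rw [← ZMod.natCast_zmod_val u, map_natCast]

theorem ZMod.sum_univ_eq_sum_range {M : Type*} [AddCommMonoid M] {n : ℕ} [NeZero n]
    (g : ℕ → M) : ∑ u : ZMod n, g u.val = ∑ k ∈ Finset.range n, g k :=
  Finset.sum_nbij' ZMod.val (fun k => (k : ZMod n))
    (fun u _ => Finset.mem_range.2 u.val_lt) (fun _ _ => Finset.mem_univ _)
    (fun u _ => ZMod.natCast_zmod_val u)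
    (fun _ hk => ZMod.val_cast_of_lt (Finset.mem_range.1 hk)) (fun _ _ => rfl)

/-- A sequence whose three-term windows sum to zero is reproduced, up to a factor, by pairing with
the weight `k ↦ cos (2πk/3)`. -/
theorem sum_range_three_mul_of_window_sum_zero {F : ℕ → ℂ}
    (hF : ∀ k, F k + F (k + 1) + F (k + 2) = 0) (m : ℕ) :
    ∑ k ∈ Finset.range (3 * m), (if 3 ∣ k then (1 : ℂ) else -1 / 2) * F k
      = 3 * m / 2 * F 0 := by
  have hper : Function.Periodic F 3 := fun k => by
    linear_combination hF (k + 1) - hF k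
  induction m with
  | zero => simp
  | succ m ih =>
    have h0 : F (3 * m) = F 0 := by simpa [mul_comm] using hper.nat_mul m 0
    rw [show 3 * (m + 1) = 3 * m + 1 + 1 + 1 by ring, Finset.sum_range_succ,
      Finset.sum_range_succ, Finset.sum_range_succ, ih, if_pos (by omega), if_neg (by omega),
      if_neg (by omega), h0]
    push_cast
    linear_combination (-1 / 2 : ℂ) * hF (3 * m) + (1 / 2 : ℂ) * h0

namespace TriominoCycle

theorem corrProj_apply {n : ℕ} {Q : Matrix (ZMod n) (ZMod n) ℂ}
    (hQ : ∀ s t, Q s t =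
      ((2 / (n : ℝ)) * Real.cos (2 * Real.pi * (((s - t : ZMod n).val : ℝ)) / 3) : ℝ))
    (s t : ZMod n) :
    Q s t = 2 / n * if 3 ∣ (s - t).val then 1 else -1 / 2 := by
  rw [hQ, Real.cos_two_pi_mul_natCast_div_three]
  split_ifs <;> push_cast <;> ring

variable {n : ℕ} [NeZero n] {D Q : Matrix (ZMod n) (ZMod n) ℂ}

theorem incidence_mul_apply (hdvd : 3 ∣ n)
    (hD : ∀ v t, D v t = if v = t ∨ v = t + 1 ∨ v = t + 2 then 1 else 0)
    (M : Matrix (ZMod n) (ZMod n) ℂ) (v t : ZMod n) :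
    (D * M) v t = M v t + M (v - 1) t + M (v - 2) t := by
  have h1 : (1 : ZMod n) ≠ 0 := fun h => by
    have := congrArg (ZMod.castHom hdvd (ZMod 3)) h
    rw [map_one, map_zero] at this
    exact absurd this (by decide)
  have h2 : (2 : ZMod n) ≠ 0 := fun h => by
    have := congrArg (ZMod.castHom hdvd (ZMod 3)) h
    rw [map_ofNat, map_zero] at this
    exact absurd this (by decide)
  have hD' : ∀ x, D v x = (if v = x then 1 else 0) + (if v - 1 = x then 1 else 0)
      + (if v - 2 = x then 1 else 0) := fun x => by
    rw [hD]
    grind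
  simp [Matrix.mul_apply, hD', add_mul, Finset.sum_add_distrib]

/-- `Q` fixes every matrix whose columns lie in the kernel of `D`. -/
theorem corrProj_mul_of_incidence_mul_eq_zero (hdvd : 3 ∣ n)
    (hD : ∀ v t, D v t = if v = t ∨ v = t + 1 ∨ v = t + 2 then 1 else 0)
    (hQ : ∀ s t, Q s t = 2 / n * if 3 ∣ (s - t).val then 1 else -1 / 2)
    {M : Matrix (ZMod n) (ZMod n) ℂ} (hM : D * M = 0) : Q * M = M := by
  ext s t
  have hF : ∀ k : ℕ, M (s - (k : ZMod n)) t + M (s - ((k + 1 : ℕ) : ZMod n)) t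
      + M (s - ((k + 2 : ℕ) : ZMod n)) t = 0 := fun k => by
    have := congrFun (congrFun hM (s - k)) t
    rw [incidence_mul_apply hdvd hD] at this
    simpa [sub_sub] using this
  obtain ⟨m, rfl⟩ := hdvd
  have hm : (m : ℂ) ≠ 0 := fun h => NeZero.ne (3 * m) (by simp [Nat.cast_eq_zero.1 h])
  calc (Q * M) s t = ∑ u : ZMod (3 * m), Q s (s - u) * M (s - u) t := by
        rw [Matrix.mul_apply]
        exact ((Equiv.subLeft s).sum_comp fun x => Q s x * M x t).symm
    _ = ∑ u : ZMod (3 * m), 2 / ((3 * m : ℕ) : ℂ) *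
          ((if 3 ∣ u.val then (1 : ℂ) else -1 / 2) * M (s - (u.val : ZMod (3 * m))) t) := by
        refine Finset.sum_congr rfl fun u _ => ?_
        rw [hQ, sub_sub_cancel, ZMod.natCast_zmod_val, mul_assoc]
    _ = M s t := by
        rw [ZMod.sum_univ_eq_sum_range fun k => 2 / ((3 * m : ℕ) : ℂ) *
          ((if 3 ∣ k then (1 : ℂ) else -1 / 2) * M (s - (k : ZMod (3 * m))) t),
          ← Finset.mul_sum,
          sum_range_three_mul_of_window_sum_zero
            (F := fun k : ℕ => M (s - (k : ZMod (3 * m))) t) hF]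
        push_cast
        rw [sub_zero]
        field_simp

theorem incidence_mul_corrProj (hdvd : 3 ∣ n)
    (hD : ∀ v t, D v t = if v = t ∨ v = t + 1 ∨ v = t + 2 then 1 else 0)
    (hQ : ∀ s t, Q s t = 2 / n * if 3 ∣ (s - t).val then 1 else -1 / 2) : D * Q = 0 := by
  ext v t
  rw [incidence_mul_apply hdvd hD, hQ, hQ, hQ, Matrix.zero_apply]
  simp only [ZMod.three_dvd_val_iff hdvd, map_sub, map_one, map_ofNat]
  generalize ZMod.castHom hdvd (ZMod 3) v = a
  generalize ZMod.castHom hdvd (ZMod 3) t = b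
  have h : ∀ a b : ZMod 3, (a - b = 0 ∧ a - 1 - b ≠ 0 ∧ a - 2 - b ≠ 0) ∨
      (a - b ≠ 0 ∧ a - 1 - b = 0 ∧ a - 2 - b ≠ 0) ∨
      (a - b ≠ 0 ∧ a - 1 - b ≠ 0 ∧ a - 2 - b = 0) := by decide
  rcases h a b with ⟨h0, h1, h2⟩ | ⟨h0, h1, h2⟩ | ⟨h0, h1, h2⟩ <;>
    simp only [h0, h1, h2, if_true, if_false] <;> ring

theorem corrProj_transpose (hdvd : 3 ∣ n)
    (hQ : ∀ s t, Q s t = 2 / n * if 3 ∣ (s - t).val then 1 else -1 / 2) : Qᵀ = Q := by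
  ext s t
  rw [Matrix.transpose_apply, hQ, hQ]
  simp only [ZMod.three_dvd_val_iff hdvd, map_sub, sub_eq_zero,
    eq_comm (a := ZMod.castHom hdvd (ZMod 3) s)]

end TriominoCycle

open scoped ComplexOrder in
/-- If `G` is a generalized inverse of `D * Dᴴ`, then `Dᴴ * G * D` acts as the identity on the
row space of `D`. -/
theorem Matrix.mul_conjTranspose_mul_mul_cancel {ι κ : Type*} [Fintype ι] [Fintype κ]
    [DecidableEq ι] {D : Matrix ι κ ℂ} {G : Matrix ι ι ℂ}
    (h : D * Dᴴ * G * (D * Dᴴ) = D * Dᴴ) : D * Dᴴ * G * D = D := by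
  have h0 : (D * Dᴴ * G * D - D) * Dᴴ = 0 := by
    rw [Matrix.sub_mul, Matrix.mul_assoc _ D, h, sub_self]
  rw [← sub_eq_zero, ← Matrix.self_mul_conjTranspose_eq_zero]
  conv_lhs => rw [Matrix.conjTranspose_sub, Matrix.conjTranspose_mul, Matrix.mul_sub, h0,
    ← Matrix.mul_assoc, h0, Matrix.zero_mul, sub_self]

/-- if 3 ∣ n, then (1/n)·DᵀΔ⁺D (with Δ⁺ the Moore–Penrose
pseudoinverse of Δ = (1/n)DDᵀ) equals the projection 1 − Q onto the span of the U_z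
with z²+z+1 ≠ 0, where the complementary projection Q (onto U_ω ⊕ U_{ω²}) has
entries Q_{s,t} = (2/n)cos(2π(s−t)/3); Q is an orthogonal projection. -/
theorem stmt13 (n : ℕ) [NeZero n] (hdvd : 3 ∣ n)
    (D : Matrix (ZMod n) (ZMod n) ℂ)
    (hD : ∀ v t, D v t = if v = t ∨ v = t + 1 ∨ v = t + 2 then 1 else 0)
    (Δ : Matrix (ZMod n) (ZMod n) ℂ) (hΔ : Δ = (n : ℂ)⁻¹ • (D * Dᵀ))
    (Δinv : Matrix (ZMod n) (ZMod n) ℂ)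
    (h1 : Δ * Δinv * Δ = Δ) (h2 : Δinv * Δ * Δinv = Δinv)
    (h3 : (Δ * Δinv)ᴴ = Δ * Δinv) (h4 : (Δinv * Δ)ᴴ = Δinv * Δ)
    (Q : Matrix (ZMod n) (ZMod n) ℂ)
    (hQ : ∀ s t, Q s t =
      ((2 / (n:ℝ)) * Real.cos (2 * Real.pi * (((s - t : ZMod n).val : ℝ)) / 3) : ℝ)) :
    (n : ℂ)⁻¹ • (Dᵀ * Δinv * D) = 1 - Q ∧ Q * Q = Q ∧ Qᴴ = Q := by
  have hn : (n : ℂ) ≠ 0 := Nat.cast_ne_zero.2 (NeZero.ne n)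
  have hQ' := TriominoCycle.corrProj_apply hQ
  have hDQ := TriominoCycle.incidence_mul_corrProj hdvd hD hQ'
  have hQT := TriominoCycle.corrProj_transpose hdvd hQ'
  have hDT : Dᴴ = Dᵀ := by
    ext v t
    simp only [Matrix.conjTranspose_apply, Matrix.transpose_apply, hD]
    split_ifs <;> simp
  have hG : D * Dᴴ * ((n : ℂ)⁻¹ • Δinv) * (D * Dᴴ) = D * Dᴴ := by
    rw [hΔ] at h1
    simp only [Matrix.smul_mul, Matrix.mul_smul] at h1
    rw [hDT, Matrix.mul_smul, Matrix.smul_mul]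
    exact smul_right_injective _ (inv_ne_zero hn) h1
  have hDP : D * ((n : ℂ)⁻¹ • (Dᵀ * Δinv * D)) = D := by
    have := Matrix.mul_conjTranspose_mul_mul_cancel hG
    simpa [hDT, Matrix.mul_assoc] using this
  have hQP : Q * ((n : ℂ)⁻¹ • (Dᵀ * Δinv * D)) = 0 := by
    have hQD : Q * Dᵀ = 0 := by
      rw [← hQT, ← Matrix.transpose_mul, hDQ, Matrix.transpose_zero]
    rw [Matrix.mul_smul, ← Matrix.mul_assoc, ← Matrix.mul_assoc, hQD]
    simp
  refine ⟨?_, TriominoCycle.corrProj_mul_of_incidence_mul_eq_zero hdvd hD hQ' hDQ, ?_⟩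
  · have hker := TriominoCycle.corrProj_mul_of_incidence_mul_eq_zero hdvd hD hQ'
      (M := 1 - (n : ℂ)⁻¹ • (Dᵀ * Δinv * D))
      (by rw [Matrix.mul_sub, hDP, Matrix.mul_one, sub_self])
    rw [Matrix.mul_sub, hQP, Matrix.mul_one, sub_zero] at hker
    rw [hker, sub_sub_cancel]
  · rw [Matrix.conjTranspose, hQT]
    ext s t
    rw [Matrix.map_apply, hQ]
    exact Complex.conj_ofReal _
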